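/- arXiv:math/0501420 — 2 statements merged into one kernel-verified Lean document; each statement's English description precedes it below -/
import Mathlib

section
/- For every real number α > 2 there exists an infinite word w on the alphabet ℕ such that the set P(w) of lengths of palindromic prefixes of w is infinite and, denoting by (n_i)_{i≥1} its increasing enumeration, limsup_{i→∞} n_{i+1}/n_i = α. -/
open Filter

/-- The prefix of length `n` of the infinite word `w`. -/
def pref {A : Type*} (w : ℕ → A) (n : ℕ) : List A := (List.range n).map w

/-- The predicate "the prefix of `w` of length `n` is a palindrome". -/
def palP {A : Type*} (w : ℕ → A) : ℕ → Prop := fun n => (pref w n).Palindrome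

noncomputable def LL (α : ℝ) : ℕ → ℕ
  | 0 => 0
  | i + 1 => ⌊α * (LL α i : ℝ)⌋₊ + 1

noncomputable def idx (α : ℝ) (x : ℕ) : ℕ := Nat.findGreatest (fun i => LL α i ≤ x) x

noncomputable def ww (α : ℝ) (x : ℕ) : ℕ :=
  if LL α (idx α x + 1) - 1 - x < x ∧ LL α (idx α x + 1) ≤ LL α (idx α x) + x then
    ww α (LL α (idx α x + 1) - 1 - x)
  else idx α x
termination_by x
decreasing_by omega

lemma LL_step (α : ℝ) (hα : 2 < α) (i : ℕ) : 2 * LL α i < LL α (i + 1) := by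
  have h : 2 * LL α i ≤ ⌊α * (LL α i : ℝ)⌋₊ := by
    apply Nat.le_floor
    push_cast
    have : (0 : ℝ) ≤ LL α i := by positivity
    nlinarith
  simp only [LL]
  omega

lemma LL_mono (α : ℝ) (hα : 2 < α) : StrictMono (LL α) :=
  strictMono_nat_of_lt_succ fun i => by have := LL_step α hα i; omega

lemma idx_eq (α : ℝ) (hα : 2 < α) (i x : ℕ) (h1 : LL α i ≤ x) (h2 : x < LL α (i + 1)) :
    idx α x = i := by
  unfold idx
  rw [Nat.findGreatest_eq_iff]
  refine ⟨(LL_mono α hα).le_apply.trans h1, fun _ => h1, fun n hn _ h => ?_⟩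
  have := (LL_mono α hα).monotone (show i + 1 ≤ n from hn)
  omega

lemma ww_mid (α : ℝ) (hα : 2 < α) (i x : ℕ) (h1 : LL α i ≤ x) (h2 : LL α i + x < LL α (i + 1)) :
    ww α x = i := by
  rw [ww, idx_eq α hα i x h1 (by omega), if_neg (by omega)]

lemma ww_refl (α : ℝ) (hα : 2 < α) (i x : ℕ) (h1 : LL α (i + 1) ≤ LL α i + x)
    (h2 : x < LL α (i + 1)) : ww α x = ww α (LL α (i + 1) - 1 - x) := by
  have := LL_step α hα i
  rw [ww, idx_eq α hα i x (by omega) (by omega), if_pos (by omega)]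

lemma exists_idx (α : ℝ) (hα : 2 < α) (x : ℕ) : ∃ i, LL α i ≤ x ∧ x < LL α (i + 1) := by
  induction x with
  | zero => exact ⟨0, by simp [LL], by simp [LL]⟩
  | succ x ih =>
    obtain ⟨i, h1, h2⟩ := ih
    by_cases h : x + 1 < LL α (i + 1)
    · exact ⟨i, by omega, h⟩
    · refine ⟨i + 1, by omega, ?_⟩
      have := LL_mono α hα (show i + 1 < i + 1 + 1 by omega)
      omega

lemma ww_lt (α : ℝ) (hα : 2 < α) (i : ℕ) : ∀ x < LL α i, ww α x < i := by
  induction i with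
  | zero => simp [LL]
  | succ i ih =>
    intro x hx
    by_cases h : x < LL α i
    · have := ih x h; omega
    by_cases h' : LL α i + x < LL α (i + 1)
    · rw [ww_mid α hα i x (by omega) h']; omega
    · rw [ww_refl α hα i x (by omega) hx]
      have := ih (LL α (i + 1) - 1 - x) (by omega)
      omega

lemma palP_iff (w : ℕ → ℕ) (n : ℕ) : palP w n ↔ ∀ x < n, w x = w (n - 1 - x) := by
  unfold palP pref
  rw [List.Palindrome.iff_reverse_eq]
  constructor
  · intro h x hx
    have := congrArg (fun l => l[x]?) h
    simp [List.getElem?_reverse, hx] at this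
    exact this.symm
  · intro h
    apply List.ext_getElem
    · simp
    · intro x h1 h2
      simp at h1 h2 ⊢
      exact (h x h1).symm

lemma pal_LL (α : ℝ) (hα : 2 < α) (i : ℕ) : palP (ww α) (LL α i) := by
  rw [palP_iff]
  cases i with
  | zero => simp [LL]
  | succ i =>
    intro x hx
    have := LL_step α hα i
    by_cases h : x < LL α i
    · rw [ww_refl α hα i (LL α (i + 1) - 1 - x) (by omega) (by omega)]
      congr 1; omega
    by_cases h' : LL α i + x < LL α (i + 1)
    · rw [ww_mid α hα i x (by omega) h', ww_mid α hα i _ (by omega) (by omega)]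
    · rw [ww_refl α hα i x (by omega) hx]

lemma pal_only (α : ℝ) (hα : 2 < α) (n : ℕ) (hp : palP (ww α) n) : ∃ i, LL α i = n := by
  rw [palP_iff] at hp
  obtain ⟨i, h1, h2⟩ := exists_idx α hα n
  refine ⟨i, ?_⟩
  by_contra hne
  have hs := LL_step α hα i
  have hi : 0 < LL α i := by
    rcases Nat.eq_zero_or_pos i with h | h
    · subst h; simp [LL] at *; omega
    · have := LL_mono α hα h; omega
  by_cases h : n ≤ LL α (i + 1) - LL α i
  · have a := hp 0 (by omega)
    rw [ww_mid α hα i (n - 1 - 0) (by omega) (by omega)] at a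
    have := ww_lt α hα i 0 hi
    omega
  · have a := hp (LL α (i + 1) - LL α i - 1) (by omega)
    rw [ww_mid α hα i _ (by omega) (by omega)] at a
    have := ww_lt α hα i (n - 1 - (LL α (i + 1) - LL α i - 1)) (by omega)
    omega

lemma nth_eq (α : ℝ) (hα : 2 < α) (i : ℕ) : Nat.nth (palP (ww α)) i = LL α i := by
  classical
  have hc : Nat.count (palP (ww α)) (LL α i) = i := by
    rw [Nat.count_eq_card_filter_range]
    have : (Finset.range (LL α i)).filter (palP (ww α)) = (Finset.range i).image (LL α) := by
      ext n
      simp only [Finset.mem_filter, Finset.mem_range, Finset.mem_image]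
      constructor
      · rintro ⟨h, hp⟩
        obtain ⟨j, rfl⟩ := pal_only α hα n hp
        exact ⟨j, (LL_mono α hα).lt_iff_lt.1 h, rfl⟩
      · rintro ⟨j, hj, rfl⟩
        exact ⟨LL_mono α hα hj, pal_LL α hα j⟩
    rw [this, Finset.card_image_of_injective _ (LL_mono α hα).injective, Finset.card_range]
  have := Nat.nth_count (pal_LL α hα i)
  rwa [hc] at this

theorem stmt3 (α : ℝ) (hα : 2 < α) :
    ∃ w : ℕ → ℕ, (setOf (palP w)).Infinite ∧
      limsup (fun i => (Nat.nth (palP w) (i + 1) : ENNReal) / (Nat.nth (palP w) i : ENNReal))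
        atTop = ENNReal.ofReal α := by
  refine ⟨ww α, ?_, ?_⟩
  · exact (Set.infinite_range_of_injective (LL_mono α hα).injective).mono
      (by rintro _ ⟨i, rfl⟩; exact pal_LL α hα i)
  · apply Tendsto.limsup_eq
    simp only [nth_eq α hα]
    have hL : Tendsto (fun i => (LL α i : ℝ)) atTop atTop :=
      tendsto_natCast_atTop_atTop.comp (LL_mono α hα).tendsto_atTop
    have h1 : Tendsto (fun i => (⌊α * (LL α i : ℝ)⌋₊ : ℝ) / (LL α i : ℝ)
        + ((LL α i : ℝ))⁻¹) atTop (nhds (α + 0)) :=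
      ((tendsto_nat_floor_mul_div_atTop (by linarith)).comp hL).add
        (tendsto_inv_atTop_zero.comp hL)
    rw [add_zero] at h1
    refine (ENNReal.tendsto_ofReal h1).congr' ?_
    filter_upwards [eventually_gt_atTop 0] with i hi
    have hp : 0 < LL α i := by have := LL_mono α hα hi; omega
    have hp' : (0 : ℝ) < LL α i := by exact_mod_cast hp
    rw [← ENNReal.ofReal_natCast, ← ENNReal.ofReal_natCast, ← ENNReal.ofReal_div_of_pos hp']
    congr 1
    rw [LL]
    push_cast
    field_simp
end

section
/- Let w be an infinite word on an alphabet A whose set P(w) of lengths of palindromic prefixes is infinite, with increasing enumeration (n_i)_{i≥1} (so n_1 = 0). Then the following are equivalent: (i) n_{i+1} ≤ 2n_i + 1 for all i ≥ 1; (ii) there exists a sequence of finite words (π_i)_{i≥1} with π_1 = ε (the empty word), every π_i a prefix of w, |π_i| < |π_{i+1}| for all i ≥ 1, |π_i| → ∞, and such that for every i ≥ 1, either π_{i+1} = π_i a π_i for some letter a ∈ A, or there exists j with 1 ≤ j ≤ i−1 and π_{i+1} = π_i u, where u is the word obtained from π_i by deleting its first |π_j| letters. -/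
open Filter

theorem pref_length' {A : Type*} (w : ℕ → A) (n : ℕ) : (pref w n).length = n := by
  simp [pref]

theorem pref_getElem' {A : Type*} (w : ℕ → A) (n i : ℕ) (h : i < (pref w n).length) :
    (pref w n)[i] = w i := by
  simp [pref]

theorem palP_iff' {A : Type*} (w : ℕ → A) (n : ℕ) :
    palP w n ↔ ∀ i j, i + j + 1 = n → w i = w j := by
  unfold palP
  rw [List.Palindrome.iff_reverse_eq]
  constructor
  · intro h i j hij
    have hi : i < (pref w n).length := by rw [pref_length']; omega
    have hj : j < (pref w n).length := by rw [pref_length']; omega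
    have h1 : (pref w n).reverse[i]? = (pref w n)[i]? := by rw [h]
    rw [List.getElem?_reverse hi] at h1
    rw [pref_length', show n - 1 - i = j by omega, List.getElem?_eq_getElem hi,
      List.getElem?_eq_getElem hj, pref_getElem', pref_getElem'] at h1
    exact (Option.some.inj h1).symm
  · intro h
    apply List.ext_getElem
    · simp
    · intro i h1 h2
      rw [List.getElem_reverse, pref_getElem', pref_getElem', pref_length']
      rw [pref_length'] at h2
      apply h
      omega

theorem pref_add' {A : Type*} (w : ℕ → A) (n m : ℕ) :
    pref w (n + m) = pref w n ++ (List.range m).map (fun t => w (n + t)) := by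
  simp [pref, List.range_add, Function.comp_def]

theorem pref_drop' {A : Type*} (w : ℕ → A) (n k : ℕ) (h : k ≤ n) :
    (pref w n).drop k = (List.range (n - k)).map (fun t => w (k + t)) := by
  obtain ⟨m, rfl⟩ := Nat.exists_eq_add_of_le h
  rw [pref_add', List.drop_left' (pref_length' w k)]
  simp

theorem map_range_inj' {A : Type*} (f g : ℕ → A) (m : ℕ) :
    (List.range m).map f = (List.range m).map g ↔ ∀ t < m, f t = g t := by
  simp [List.map_inj_left]

theorem step_one {A : Type*} (w : ℕ → A) (n : ℕ) :
    (∃ a, pref w (2 * n + 1) = pref w n ++ a :: pref w n) ↔ ∀ t < n, w (n + 1 + t) = w t := by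
  have key : pref w (2 * n + 1) =
      pref w n ++ w n :: (List.range n).map (fun t => w (n + 1 + t)) := by
    rw [show 2 * n + 1 = n + 1 + n by ring, pref_add', pref_add' w n 1]
    simp
  rw [key, ← map_range_inj']
  constructor
  · rintro ⟨a, h⟩
    have := List.append_cancel_left h
    exact (List.cons.inj this).2
  · intro h
    exact ⟨w n, by rw [h]; rfl⟩

theorem step_two {A : Type*} (w : ℕ → A) (n k : ℕ) (h : k ≤ n) :
    pref w (n + (n - k)) = pref w n ++ (pref w n).drop k ↔
      ∀ t < n - k, w (n + t) = w (k + t) := by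
  rw [pref_add', pref_drop' w n k h, List.append_right_inj, map_range_inj']

theorem stmt9 {A : Type*} (w : ℕ → A) (hinf : (setOf (palP w)).Infinite) :
    (∀ i, Nat.nth (palP w) (i + 1) ≤ 2 * Nat.nth (palP w) i + 1) ↔
    ∃ π : ℕ → List A, π 0 = [] ∧
      (∀ i, pref w (π i).length = π i) ∧
      (∀ i, (π i).length < (π (i + 1)).length) ∧
      Tendsto (fun i => (π i).length) atTop atTop ∧
      ∀ i, (∃ a : A, π (i + 1) = π i ++ a :: π i) ∨
        (∃ j < i, π (i + 1) = π i ++ (π i).drop (π j).length) := by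
  have hmono : StrictMono (Nat.nth (palP w)) := Nat.nth_strictMono hinf
  have hp0 : palP w 0 := by rw [palP_iff']; intro i j h; omega
  constructor
  · intro H
    refine ⟨fun i => pref w (Nat.nth (palP w) i), ?_, ?_, ?_, ?_, ?_⟩
    · simp [Nat.nth_zero_of_zero hp0, pref]
    · intro i; simp only [pref_length']
    · intro i; simp only [pref_length']; exact hmono (Nat.lt_succ_self i)
    · simp only [pref_length']; exact hmono.tendsto_atTop
    · intro i
      have hN := (palP_iff' w _).1 (Nat.nth_mem_of_infinite hinf (i + 1))
      have hn := (palP_iff' w _).1 (Nat.nth_mem_of_infinite hinf i)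
      have hlt := hmono (Nat.lt_succ_self i)
      have hle := H i
      simp only [pref_length', Nat.succ_eq_add_one] at *
      generalize hNe : Nat.nth (palP w) (i + 1) = N at *
      generalize hne : Nat.nth (palP w) i = n at *
      by_cases hc : N = 2 * n + 1
      · left
        subst hc
        rw [step_one]
        intro t ht
        rw [hN (n + 1 + t) (n - 1 - t) (by omega)]
        exact hn _ _ (by omega)
      · right
        obtain ⟨k, hk⟩ : ∃ k, N + k = 2 * n := ⟨2 * n - N, by omega⟩
        have hkp : palP w k := by
          rw [palP_iff']
          intro a b hab
          rw [hn a (n - 1 - a) (by omega), hN (n - 1 - a) (N - n + a) (by omega)]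
          exact hn _ _ (by omega)
        obtain ⟨j, hj⟩ : ∃ j, Nat.nth (palP w) j = k := by
          classical
          exact ⟨Nat.count (palP w) k, Nat.nth_count hkp⟩
        refine ⟨j, ?_, ?_⟩
        · apply hmono.lt_iff_lt.1
          omega
        · rw [hj, show N = n + (n - k) by omega, step_two w n k (by omega)]
          intro t ht
          rw [hN (n + t) (n - k - 1 - t) (by omega)]
          exact hn _ _ (by omega)
  · rintro ⟨π, h0, hpre, hlt, htend, hstep⟩
    have hm : StrictMono (fun i => (π i).length) := strictMono_nat_of_lt_succ hlt
    have hpal : ∀ i, palP w (π i).length := by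
      intro i
      induction i using Nat.strong_induction_on with
      | _ i ih =>
      rcases i with _ | i
      · rw [h0]; exact hp0
      · have hn := (palP_iff' w _).1 (ih i (Nat.lt_succ_self i))
        rcases hstep i with ⟨a, ha⟩ | ⟨j, hj, ha⟩
        · have hl : (π (i + 1)).length = 2 * (π i).length + 1 := by
            rw [ha]; simp; omega
          rw [← hpre (i + 1), ← hpre i, hl] at ha
          have hs := (step_one w _).1 ⟨a, by simpa only [pref_length'] using ha⟩
          rw [hl, palP_iff']
          generalize (π i).length = n at *
          have main : ∀ a b, a < n → a + b + 1 = 2 * n + 1 → w a = w b := by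
            intro a b h1 h2
            rw [show b = n + 1 + (n - 1 - a) by omega, hs _ (by omega)]
            exact hn _ _ (by omega)
          intro a b hab
          rcases lt_trichotomy a n with h | h | h
          · exact main a b h hab
          · rw [show a = b by omega]
          · exact (main b a (by omega) (by omega)).symm
        · have hkl : (π j).length < (π i).length := hm hj
          have hkp := (palP_iff' w _).1 (ih j (by omega))
          have hl : (π (i + 1)).length = (π i).length + ((π i).length - (π j).length) := by
            rw [ha]; simp
          rw [← hpre (i + 1), ← hpre i, hl] at ha
          have hs := (step_two w _ _ hkl.le).1 ha
          rw [hl, palP_iff']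
          clear ha hl
          generalize (π i).length = n at *
          generalize (π j).length = k at *
          have main : ∀ a b, n ≤ a → a + b + 1 = n + (n - k) → w a = w b := by
            intro a b h1 h2
            rw [show a = n + (a - n) by omega, hs _ (by omega)]
            exact hn _ _ (by omega)
          intro a b hab
          by_cases h : n ≤ a
          · exact main a b h hab
          by_cases h' : n ≤ b
          · exact (main b a h' (by omega)).symm
          rw [hn a (n - 1 - a) (by omega), hn b (n - 1 - b) (by omega)]
          exact hkp _ _ (by omega)
    have hbd : ∀ i, (π (i + 1)).length ≤ 2 * (π i).length + 1 := by
      intro i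
      rcases hstep i with ⟨a, ha⟩ | ⟨j, hj, ha⟩
      · rw [ha]; simp; omega
      · rw [ha]; simp; omega
    intro i
    generalize hne : Nat.nth (palP w) i = n
    have hex : ∃ k, n < (π k).length := ⟨n + 1, lt_of_lt_of_le (Nat.lt_succ_self n) (hm.le_apply)⟩
    classical
    obtain ⟨k, hk, hmin⟩ : ∃ k, n < (π k).length ∧ ∀ l < k, ¬ n < (π l).length :=
      ⟨Nat.find hex, Nat.find_spec hex, fun l hl => Nat.find_min hex hl⟩
    rcases k with _ | k
    · rw [h0] at hk; simp at hk
    · have h1 := hmin k (Nat.lt_succ_self k)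
      have h2 := hbd k
      have h3 : Nat.nth (palP w) (i + 1) ≤ (π (k + 1)).length := by
        have hc := Nat.nth_count (hpal (k + 1))
        rw [← hc]
        apply hmono.monotone
        apply hmono.lt_iff_lt.1
        rw [hc, hne]; exact hk
      omega
end
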